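/- Let (v_1,…,v_l) be a planar vortex solution. Then for every j = 1,…,l the function f_j e^{v_j} + Σ_{i=1}^l f_i e^{v_i} − (l+1) is integrable on ℝ² and ∫_{ℝ²} ( f_j(x) e^{v_j(x)} + Σ_{i=1}^l f_i(x) e^{v_i(x)} − (l+1) ) dx = −4πN_j. -/

import Mathlib

open MeasureTheory Real Set Filter

noncomputable section

/-- The plane `ℝ²` with the Euclidean norm. -/
abbrev E2 := EuclideanSpace ℝ (Fin 2)

/-- The Laplacian of a function `f : ℝ² → ℝ`, as the sum of its second partial
derivatives in the coordinate directions. -/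
noncomputable def lap (f : E2 → ℝ) (x : E2) : ℝ :=
  ∑ i : Fin 2,
    fderiv ℝ (fun y => fderiv ℝ f y (EuclideanSpace.single i 1)) x (EuclideanSpace.single i 1)

/-- Vortex data for the planar problem: a parameter `μ > 0` and, for each `j = 1, …, l`,
`N j` points `p j k` in the plane (repetitions allowed). -/
structure PlanarVortexData (l : ℕ) where
  μ : ℝ
  μ_pos : 0 < μ
  N : Fin l → ℕ
  p : ∀ j : Fin l, Fin (N j) → E2

namespace PlanarVortexData

variable {l : ℕ} (D : PlanarVortexData l)

/-- `f_j(x) = Π_{k=1}^{N_j} ‖x − p_{j,k}‖²/(μ + ‖x − p_{j,k}‖²)`. -/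
def f (j : Fin l) (x : E2) : ℝ :=
  ∏ k, ‖x - D.p j k‖ ^ 2 / (D.μ + ‖x - D.p j k‖ ^ 2)

/-- `g_j(x) = Σ_{k=1}^{N_j} 4μ/(μ + ‖x − p_{j,k}‖²)²`. -/
def g (j : Fin l) (x : E2) : ℝ :=
  ∑ k, 4 * D.μ / (D.μ + ‖x - D.p j k‖ ^ 2) ^ 2

end PlanarVortexData

/-- `(v_1, …, v_l)` is a planar vortex solution for the data `D`: each `v_j` is `C²`,
solves `Δ v_j = f_j e^{v_j} + Σ_i f_i e^{v_i} − (l+1) + g_j` on `ℝ²`, and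
`v_j(x) → 0` as `‖x‖ → ∞`. -/
def IsPlanarVortexSolution {l : ℕ} (D : PlanarVortexData l) (v : Fin l → E2 → ℝ) : Prop :=
  ∀ j : Fin l,
    ContDiff ℝ 2 (v j) ∧
    (∀ x : E2, lap (v j) x =
      D.f j x * Real.exp (v j x) + ∑ i, D.f i x * Real.exp (v i x) - (l + 1) + D.g j x) ∧
    Tendsto (v j) (cocompact E2) (nhds 0)

open Topology

/-- `φ` is twice differentiable at `0` with first and second derivatives `b`, `c`. -/
def HasD2 (φ : ℝ → ℝ) (b c : ℝ) : Prop :=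
  ∃ φ' : ℝ → ℝ, (∀ᶠ t in 𝓝 (0:ℝ), HasDerivAt φ (φ' t) t) ∧ φ' 0 = b ∧ HasDerivAt φ' c 0

lemma HasD2.add {φ ψ : ℝ → ℝ} {b c b' c' : ℝ} (h : HasD2 φ b c) (k : HasD2 ψ b' c') :
    HasD2 (fun t => φ t + ψ t) (b + b') (c + c') := by
  obtain ⟨φ', h1, h2, h3⟩ := h
  obtain ⟨ψ', k1, k2, k3⟩ := k
  refine ⟨fun t => φ' t + ψ' t, ?_, by simp [h2, k2], h3.add k3⟩
  filter_upwards [h1, k1] with t a b using a.add b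

lemma HasD2.const_mul {φ : ℝ → ℝ} {b c : ℝ} (C : ℝ) (h : HasD2 φ b c) :
    HasD2 (fun t => C * φ t) (C * b) (C * c) := by
  obtain ⟨φ', h1, h2, h3⟩ := h
  refine ⟨fun t => C * φ' t, ?_, by simp [h2], h3.const_mul C⟩
  filter_upwards [h1] with t a using a.const_mul C

lemma HasD2.sq {φ : ℝ → ℝ} {b c : ℝ} (h : HasD2 φ b c) :
    HasD2 (fun t => φ t ^ 2) (2 * φ 0 * b) (2 * b ^ 2 + 2 * φ 0 * c) := by
  obtain ⟨φ', h1, h2, h3⟩ := h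
  refine ⟨fun t => 2 * φ t * φ' t, ?_, by simp [h2], ?_⟩
  · filter_upwards [h1] with t a
    have := a.pow 2
    convert! this using 1
    simp
  · have := (h1.self_of_nhds.const_mul 2).mul h3
    convert! this using 1
    rw [h2]; ring

lemma HasD2.sum {ι : Type*} (s : Finset ι) {φ : ι → ℝ → ℝ} {b c : ι → ℝ}
    (h : ∀ i ∈ s, HasD2 (φ i) (b i) (c i)) :
    HasD2 (fun t => ∑ i ∈ s, φ i t) (∑ i ∈ s, b i) (∑ i ∈ s, c i) := by
  classical
  induction s using Finset.induction_on with
  | empty =>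
    refine ⟨fun _ => 0, ?_, by simp, by simpa using hasDerivAt_const (0:ℝ) (0:ℝ)⟩
    exact Eventually.of_forall fun t => by simpa using hasDerivAt_const t (0:ℝ)
  | insert a s ha ih =>
    simp only [Finset.sum_insert ha]
    exact (h a (by simp)).add (ih fun i hi => h i (by simp [hi]))

/-- logarithm of a quadratic -/
lemma HasD2.log_quad (q y : ℝ) (hq : 0 < q) :
    HasD2 (fun t => Real.log (q + 2 * t * y + t ^ 2)) (2 * y / q) (2 / q - 4 * y ^ 2 / q ^ 2) := by
  have hc : Continuous fun t : ℝ => q + 2 * t * y + t ^ 2 := by fun_prop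
  have hd : ∀ t : ℝ, HasDerivAt (fun t : ℝ => q + 2 * t * y + t ^ 2) (2 * y + 2 * t) t := by
    intro t
    have h1 := ((((hasDerivAt_id t).const_mul 2).mul_const y).const_add q).add
      ((hasDerivAt_id t).pow 2)
    convert! h1 using 1
    simp
  have hd2 : HasDerivAt (fun t : ℝ => 2 * y + 2 * t) 2 0 := by
    simpa using ((hasDerivAt_id (0:ℝ)).const_mul 2).const_add (2 * y)
  refine ⟨fun t => (2 * y + 2 * t) / (q + 2 * t * y + t ^ 2), ?_, by simp, ?_⟩
  · have : ∀ᶠ t in 𝓝 (0:ℝ), 0 < q + 2 * t * y + t ^ 2 :=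
      hc.continuousAt.eventually_const_lt (by simpa using hq)
    filter_upwards [this] with t ht
    exact (hd t).log ht.ne'
  · have := hd2.div (hd 0) (by simpa using hq.ne')
    convert! this using 1
    simp
    field_simp
    ring

/-- the barrier -/
lemma HasD2.inv_quad (q y : ℝ) (hq : 0 < q) :
    HasD2 (fun t => ((q + 2 * t * y + t ^ 2) ^ 3)⁻¹) (-6 * y / q ^ 4)
      (48 * y ^ 2 / q ^ 5 - 6 / q ^ 4) := by
  have hc : Continuous fun t : ℝ => q + 2 * t * y + t ^ 2 := by fun_prop
  have hd : ∀ t : ℝ, HasDerivAt (fun t : ℝ => q + 2 * t * y + t ^ 2) (2 * y + 2 * t) t := by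
    intro t
    have h1 := ((((hasDerivAt_id t).const_mul 2).mul_const y).const_add q).add
      ((hasDerivAt_id t).pow 2)
    convert! h1 using 1
    simp
  have hd2 : HasDerivAt (fun t : ℝ => 2 * y + 2 * t) 2 0 := by
    simpa using ((hasDerivAt_id (0:ℝ)).const_mul 2).const_add (2 * y)
  refine ⟨fun t => -3 * (2 * y + 2 * t) / (q + 2 * t * y + t ^ 2) ^ 4, ?_, by simp; ring, ?_⟩
  · have : ∀ᶠ t in 𝓝 (0:ℝ), 0 < q + 2 * t * y + t ^ 2 :=
      hc.continuousAt.eventually_const_lt (by simpa using hq)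
    filter_upwards [this] with t ht
    have := ((hd t).pow 3).inv (pow_ne_zero 3 ht.ne')
    convert! this using 1
    simp
    field_simp
  · have := (hd2.const_mul (-3)).div ((hd 0).pow 4) (by simpa using hq.ne')
    convert! this using 1
    simp
    field_simp
    ring

lemma HasD2.nonpos_of_isLocalMax {φ : ℝ → ℝ} {b c : ℝ} (h : HasD2 φ b c)
    (hm : IsLocalMax φ 0) : c ≤ 0 := by
  obtain ⟨φ', h1, h2, h3⟩ := h
  by_contra! hc
  have hd : deriv φ =ᶠ[𝓝 0] φ' := by filter_upwards [h1] with t ht using ht.deriv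
  have hdd : deriv (deriv φ) 0 = c := by rw [hd.deriv_eq]; exact h3.deriv
  have hmin : IsLocalMin φ 0 := isLocalMin_of_deriv_deriv_pos (by rw [hdd]; exact hc)
    hm.deriv_eq_zero h1.self_of_nhds.continuousAt
  have hconst : φ =ᶠ[𝓝 0] fun _ => φ 0 := by
    filter_upwards [hm, hmin] with t a b using le_antisymm a b
  have h0 : deriv φ =ᶠ[𝓝 0] fun _ => 0 := by
    filter_upwards [hconst.eventuallyEq_nhds] with t ht
    rw [ht.deriv_eq]; simp
  rw [h0.deriv_eq] at hdd
  simp at hdd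
  linarith

/-- the direction -/
abbrev ee (i : Fin 2) : E2 := EuclideanSpace.single i 1

lemma norm_line (x : E2) (i : Fin 2) (t : ℝ) :
    ‖x + t • ee i‖ ^ 2 = ‖x‖ ^ 2 + 2 * t * x i + t ^ 2 := by
  fin_cases i <;> simp [EuclideanSpace.norm_sq_eq, Fin.sum_univ_two] <;> ring

lemma contDiff_fderiv_dir {f : E2 → ℝ} {n m : ℕ∞} (hf : ContDiff ℝ n f) (hm : m + 1 ≤ n) (e : E2) :
    ContDiff ℝ m (fun y => fderiv ℝ f y e) := by
  have := hf.fderiv_right (m := m) (by exact_mod_cast hm)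
  fun_prop

lemma hasD2_of_contDiff {f : E2 → ℝ} (hf : ContDiff ℝ 2 f) (x e : E2) :
    HasD2 (fun t => f (x + t • e)) (fderiv ℝ f x e)
      (fderiv ℝ (fun y => fderiv ℝ f y e) x e) := by
  have hl : ∀ t : ℝ, HasDerivAt (fun t : ℝ => x + t • e) e t := fun t => by
    simpa using ((hasDerivAt_id t).smul_const e).const_add x
  have h1 : Differentiable ℝ f := hf.differentiable (by norm_num)
  have h2 : Differentiable ℝ (fun y => fderiv ℝ f y e) :=
    (contDiff_fderiv_dir (n := 2) (m := 1) hf (by norm_num) e).differentiable (by norm_num)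
  refine ⟨fun t => fderiv ℝ f (x + t • e) e, Eventually.of_forall fun t => ?_, by simp, ?_⟩
  · exact (h1 _).hasFDerivAt.comp_hasDerivAt t (hl t)
  · have := (h2 (x + (0:ℝ) • e)).hasFDerivAt.comp_hasDerivAt 0 (hl 0)
    simp only [zero_smul, add_zero] at this
    exact this
lemma integral_bubble {μ : ℝ} (hμ : 0 < μ) :
    Integrable (fun x : E2 => 4 * μ / (μ + ‖x‖ ^ 2) ^ 2) volume ∧
    ∫ x : E2, 4 * μ / (μ + ‖x‖ ^ 2) ^ 2 = 4 * π := by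
  have hder : ∀ y ∈ Ici (0:ℝ), HasDerivAt (fun y : ℝ => -(2 * μ) / (μ + y ^ 2))
      (y ^ (2 - 1) • (4 * μ / (μ + y ^ 2) ^ 2)) y := by
    intro y _
    have h1 : HasDerivAt (fun y : ℝ => μ + y ^ 2) (2 * y) y := by
      simpa using (hasDerivAt_pow 2 y).const_add μ
    have hp : μ + y ^ 2 ≠ 0 := by positivity
    convert! (hasDerivAt_const y (-(2 * μ))).div h1 hp using 1
    simp
    ring
  have hpos : ∀ y ∈ Ioi (0:ℝ), 0 ≤ y ^ (2 - 1) • (4 * μ / (μ + y ^ 2) ^ 2) := by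
    intro y hy
    have : (0:ℝ) < y := hy
    simp only [smul_eq_mul]
    positivity
  have hlim : Tendsto (fun y : ℝ => -(2 * μ) / (μ + y ^ 2)) atTop (𝓝 0) := by
    apply Tendsto.const_div_atTop
    exact tendsto_atTop_add_const_left _ _ (tendsto_pow_atTop (by norm_num))
  have hfr : Module.finrank ℝ E2 = 2 := by simp
  constructor
  · have := (integrable_fun_norm_addHaar (volume : Measure E2)
      (f := fun y : ℝ => 4 * μ / (μ + y ^ 2) ^ 2)).2
    apply this
    rw [hfr]
    exact integrableOn_Ioi_deriv_of_nonneg' hder hpos hlim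
  · rw [integral_fun_norm_addHaar (volume : Measure E2) (fun y : ℝ => 4 * μ / (μ + y ^ 2) ^ 2), hfr,
      integral_Ioi_of_hasDerivAt_of_nonneg' hder hpos hlim]
    have : (volume : Measure E2).real (Metric.ball 0 1) = π := by
      simp [Measure.real, EuclideanSpace.volume_ball_fin_two, Real.pi_pos.le]
    rw [this]
    simp
    field_simp
    ring

lemma contDiff_d2 {f : E2 → ℝ} (hf : ContDiff ℝ 2 f) (e : E2) :
    Continuous (fun x => fderiv ℝ (fun y => fderiv ℝ f y e) x e) :=
  (contDiff_fderiv_dir (n := 1) (m := 0)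
    (contDiff_fderiv_dir (n := 2) (m := 1) hf (by norm_num) e) (by norm_num) e).continuous

lemma continuous_lap {f : E2 → ℝ} (hf : ContDiff ℝ 2 f) : Continuous (lap f) := by
  unfold lap
  exact continuous_finsetSum _ fun i _ => contDiff_d2 hf _

lemma hasCompactSupport_dir {f : E2 → ℝ} (hf : HasCompactSupport f) (e : E2) :
    HasCompactSupport (fun x => fderiv ℝ f x e) :=
  hf.fderiv_apply (𝕜 := ℝ) e

lemma hasCompactSupport_lap {f : E2 → ℝ} (hf : HasCompactSupport f) :
    HasCompactSupport (lap f) := by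
  have h : ∀ i : Fin 2, HasCompactSupport (fun x => fderiv ℝ (fun y => fderiv ℝ f y (ee i)) x (ee i)) :=
    fun i => hasCompactSupport_dir (hasCompactSupport_dir hf _) _
  have := (h 0).add (h 1)
  have e : lap f = (fun x => fderiv ℝ (fun y => fderiv ℝ f y (ee 0)) x (ee 0)) +
     (fun x => fderiv ℝ (fun y => fderiv ℝ f y (ee 1)) x (ee 1)) := by
    ext x; simp [lap, Fin.sum_univ_two]
  rw [e]; exact this

lemma ibp1 {f g : E2 → ℝ} (hf : ContDiff ℝ 1 f) (hg : ContDiff ℝ 1 g)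
    (hs : HasCompactSupport f) (e : E2) :
    ∫ x, f x * fderiv ℝ g x e = - ∫ x, fderiv ℝ f x e * g x := by
  have c1 : Continuous (fun x => fderiv ℝ f x e) :=
    (contDiff_fderiv_dir (n := 1) (m := 0) hf (by norm_num) e).continuous
  have c2 : Continuous (fun x => fderiv ℝ g x e) :=
    (contDiff_fderiv_dir (n := 1) (m := 0) hg (by norm_num) e).continuous
  apply integral_mul_fderiv_eq_neg_fderiv_mul_of_integrable
  · exact (c1.mul hg.continuous).integrable_of_hasCompactSupport
      ((hasCompactSupport_dir hs e).mul_right)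
  · exact (hf.continuous.mul c2).integrable_of_hasCompactSupport (hs.mul_right)
  · exact (hf.continuous.mul hg.continuous).integrable_of_hasCompactSupport (hs.mul_right)
  · exact fun x _ => hf.differentiable (by norm_num) x
  · exact fun x _ => hg.differentiable (by norm_num) x

lemma green {f g : E2 → ℝ} (hf : ContDiff ℝ 2 f) (hg : ContDiff ℝ 2 g)
    (hs : HasCompactSupport f) :
    ∫ x, f x * lap g x = ∫ x, lap f x * g x := by
  have key : ∀ e : E2, ∫ x, f x * fderiv ℝ (fun y => fderiv ℝ g y e) x e =
      ∫ x, fderiv ℝ (fun y => fderiv ℝ f y e) x e * g x := by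
    intro e
    have df := contDiff_fderiv_dir (n := 2) (m := 1) hf (by norm_num) e
    have dg := contDiff_fderiv_dir (n := 2) (m := 1) hg (by norm_num) e
    rw [ibp1 (hf.of_le (by norm_num)) dg hs e,
      ibp1 df (hg.of_le (by norm_num)) (hasCompactSupport_dir hs e) e]
    simp
  simp only [lap, Finset.mul_sum, Finset.sum_mul]
  rw [integral_finsetSum, integral_finsetSum]
  · exact Finset.sum_congr rfl fun i _ => key _
  · intro i _
    exact ((contDiff_d2 hf _).mul hg.continuous).integrable_of_hasCompactSupport
      ((hasCompactSupport_dir (hasCompactSupport_dir hs _) _).mul_right)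
  · intro i _
    exact (hf.continuous.mul (contDiff_d2 hg _)).integrable_of_hasCompactSupport (hs.mul_right)

lemma lap_scale {f : E2 → ℝ} (hf : ContDiff ℝ 2 f) (c : ℝ) (x : E2) :
    lap (fun y => f (c • y)) x = c ^ 2 * lap f (c • x) := by
  have key : ∀ (g : E2 → ℝ) (_ : Differentiable ℝ g) (e y : E2),
      fderiv ℝ (fun y => g (c • y)) y e = c * fderiv ℝ g (c • y) e := by
    intro g hg e y
    have h1 : HasFDerivAt (fun y : E2 => c • y) (c • ContinuousLinearMap.id ℝ E2) y :=
      (hasFDerivAt_id y).const_smul c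
    have := (hg (c • y)).hasFDerivAt.comp y h1
    have h2 : fderiv ℝ (fun y => g (c • y)) y = _ := this.fderiv
    rw [h2]; simp
  unfold lap
  rw [Finset.mul_sum]
  refine Finset.sum_congr rfl fun i _ => ?_
  have h2 : Differentiable ℝ (fun y => fderiv ℝ f y (EuclideanSpace.single i 1)) :=
    (contDiff_fderiv_dir (n := 2) (m := 1) hf (by norm_num) _).differentiable (by norm_num)
  simp_rw [key f (hf.differentiable (by norm_num))]
  rw [fderiv_const_mul (show DifferentiableAt ℝ (fun y => fderiv ℝ f (c • y) (EuclideanSpace.single i 1)) x from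
    h2.comp (differentiable_id.const_smul c) x)]
  have := key _ h2 (EuclideanSpace.single i 1) x
  simp only [smul_apply, smul_eq_mul] at this ⊢
  rw [this]; ring

lemma bounded_of_tendsto {v : E2 → ℝ} (hc : Continuous v)
    (h0 : Tendsto v (cocompact E2) (𝓝 0)) : ∃ M, ∀ x, |v x| ≤ M := by
  have h1 : ∀ᶠ x in cocompact E2, |v x| < 1 := by
    have := h0.abs
    simp only [abs_zero] at this
    exact this.eventually_lt_const (by norm_num)
  rw [Filter.eventually_iff, mem_cocompact] at h1
  obtain ⟨K, hK, hsub⟩ := h1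
  obtain ⟨M, hM⟩ := hK.exists_bound_of_continuousOn hc.continuousOn
  refine ⟨max M 1, fun x => ?_⟩
  by_cases hx : x ∈ K
  · exact (hM x hx).trans (le_max_left _ _)
  · exact (le_of_lt (hsub hx)).trans (le_max_right _ _)

lemma integral_lap_eq_zero {v : E2 → ℝ} (hv : ContDiff ℝ 2 v)
    (h0 : Tendsto v (cocompact E2) (𝓝 0)) (hi : Integrable (lap v) volume) :
    ∫ x, lap v x = 0 := by
  obtain ⟨M, hM⟩ := bounded_of_tendsto hv.continuous h0
  let χ : ContDiffBump (0 : E2) := ⟨1, 2, by norm_num, by norm_num⟩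
  have hχ : ContDiff ℝ 2 χ := χ.contDiff
  have hχs : HasCompactSupport χ := χ.hasCompactSupport
  -- the sequence of cutoffs
  have hn : ∀ n : ℕ, (0:ℝ) < (n:ℝ) + 1 := fun n => by positivity
  have hEq : ∀ n : ℕ, ∫ x, χ (((n:ℝ) + 1)⁻¹ • x) * lap v x =
      ∫ y, lap χ y * v (((n:ℝ) + 1) • y) := by
    intro n
    have hR := hn n
    set R : ℝ := (n:ℝ) + 1
    have hsm : ContDiff ℝ 2 (fun x : E2 => χ (R⁻¹ • x)) :=
      hχ.comp (contDiff_id.const_smul _)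
    have hsc : HasCompactSupport (fun x : E2 => χ (R⁻¹ • x)) :=
      hχs.comp_smul (inv_ne_zero hR.ne')
    rw [green hsm hv hsc]
    have := Measure.integral_comp_inv_smul (volume : Measure E2)
      (fun y => R⁻¹ ^ 2 * lap χ y * v (R • y)) R
    simp only [smul_smul, mul_inv_cancel₀ hR.ne', one_smul] at this
    simp_rw [lap_scale hχ]
    rw [this]
    have hfr : Module.finrank ℝ E2 = 2 := by simp
    rw [hfr, abs_of_pos (by positivity)]
    simp_rw [mul_assoc]
    rw [integral_const_mul, smul_eq_mul, ← mul_assoc]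
    field_simp
  have hL : Tendsto (fun n : ℕ => ∫ x, χ (((n:ℝ) + 1)⁻¹ • x) * lap v x) atTop
      (𝓝 (∫ x, lap v x)) := by
    apply tendsto_integral_of_dominated_convergence (fun x => |lap v x|)
    · intro n
      apply Continuous.aestronglyMeasurable
      have := continuous_lap hv
      have := hχ.continuous
      fun_prop
    · exact hi.abs
    · intro n
      refine Eventually.of_forall fun x => ?_
      rw [norm_mul]
      have h1 : ‖χ (((n:ℝ) + 1)⁻¹ • x)‖ ≤ 1 := by
        rw [Real.norm_eq_abs, abs_of_nonneg χ.nonneg]; exact χ.le_one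
      have := mul_le_mul_of_nonneg_right h1 (norm_nonneg (lap v x))
      simpa using this
    · refine Eventually.of_forall fun x => ?_
      have h1 : Tendsto (fun n : ℕ => ((n:ℝ) + 1)⁻¹ • x) atTop (𝓝 ((0:ℝ) • x)) := by
        apply Tendsto.smul_const
        simpa using tendsto_one_div_add_atTop_nhds_zero_nat (𝕜 := ℝ)
      rw [zero_smul] at h1
      have h2 := (hχ.continuous.tendsto 0).comp h1
      have h3 : χ (0 : E2) = 1 := χ.one_of_mem_closedBall (by simp [χ])
      rw [h3] at h2
      simpa using h2.mul_const (lap v x)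
  have hRt : Tendsto (fun n : ℕ => ∫ y, lap χ y * v (((n:ℝ) + 1) • y)) atTop
      (𝓝 (∫ _y : E2, (0:ℝ))) := by
    have hlc := continuous_lap hχ
    apply tendsto_integral_of_dominated_convergence (fun x => |lap χ x| * M)
    · intro n
      apply Continuous.aestronglyMeasurable
      have := hv.continuous
      fun_prop
    · exact ((hlc.integrable_of_hasCompactSupport (hasCompactSupport_lap hχs)).abs).mul_const M
    · intro n
      refine Eventually.of_forall fun x => ?_
      rw [norm_mul]
      exact mul_le_mul_of_nonneg_left (hM _) (norm_nonneg _)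
    · have hne : ∀ᵐ y : E2, y ≠ 0 := by
        simp [ae_iff]
      filter_upwards [hne] with y hy
      have h1 : Tendsto (fun n : ℕ => ((n:ℝ) + 1) • y) atTop (cocompact E2) := by
        rw [← Metric.cobounded_eq_cocompact, ← tendsto_norm_atTop_iff_cobounded]
        have h2 : Tendsto (fun n : ℕ => ((n:ℝ) + 1) * ‖y‖) atTop atTop :=
          (tendsto_atTop_add_const_right _ _ tendsto_natCast_atTop_atTop).atTop_mul_const
            (norm_pos_iff.2 hy)
        refine h2.congr fun n => ?_
        rw [norm_smul, Real.norm_eq_abs, abs_of_pos (hn n)]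
      simpa using (h0.comp h1).const_mul (lap χ y)
  simp_rw [hEq] at hL
  have := tendsto_nhds_unique hL hRt
  simpa using this
section Decay

variable {l : ℕ} (D : PlanarVortexData l)

/-- `log f_j`. -/
def LL (j : Fin l) (x : E2) : ℝ :=
  ∑ k, (Real.log (‖x - D.p j k‖ ^ 2) - Real.log (D.μ + ‖x - D.p j k‖ ^ 2))

lemma exp_LL (j : Fin l) (x : E2) (hx : ∀ k, x ≠ D.p j k) : Real.exp (LL D j x) = D.f j x := by
  unfold LL PlanarVortexData.f
  rw [Real.exp_sum]
  refine Finset.prod_congr rfl fun k _ => ?_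
  have h1 : 0 < ‖x - D.p j k‖ := norm_pos_iff.2 (sub_ne_zero.2 (hx k))
  have h2 := D.μ_pos
  rw [Real.exp_sub, Real.exp_log (by positivity), Real.exp_log (by positivity)]

lemma hasD2_LL (j : Fin l) (x : E2) (hx : ∀ k, x ≠ D.p j k) :
    ∃ b c : Fin 2 → ℝ, (∀ i, HasD2 (fun t => LL D j (x + t • ee i)) (b i) (c i)) ∧
      ∑ i, c i = - D.g j x := by
  have hμ := D.μ_pos
  have hq : ∀ k, 0 < ‖x - D.p j k‖ ^ 2 := fun k => by
    have : 0 < ‖x - D.p j k‖ := norm_pos_iff.2 (sub_ne_zero.2 (hx k))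
    positivity
  have hq' : ∀ k, 0 < D.μ + ‖x - D.p j k‖ ^ 2 := fun k => by positivity
  have key : ∀ (i : Fin 2) (k : Fin (D.N j)) (t : ℝ), ‖x + t • ee i - D.p j k‖ ^ 2 =
      ‖x - D.p j k‖ ^ 2 + 2 * t * (x - D.p j k) i + t ^ 2 := by
    intro i k t
    rw [← norm_line]
    congr 2
    abel
  refine ⟨fun i => ∑ k, (2 * (x - D.p j k) i / ‖x - D.p j k‖ ^ 2 +
      -1 * (2 * (x - D.p j k) i / (D.μ + ‖x - D.p j k‖ ^ 2))),
    fun i => ∑ k, (2 / ‖x - D.p j k‖ ^ 2 - 4 * (x - D.p j k) i ^ 2 / (‖x - D.p j k‖ ^ 2) ^ 2 +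
      -1 * (2 / (D.μ + ‖x - D.p j k‖ ^ 2) -
        4 * (x - D.p j k) i ^ 2 / (D.μ + ‖x - D.p j k‖ ^ 2) ^ 2)), fun i => ?_, ?_⟩
  · have h := HasD2.sum Finset.univ (fun k (_ : k ∈ Finset.univ) =>
      (HasD2.log_quad _ ((x - D.p j k) i) (hq k)).add
        ((HasD2.log_quad _ ((x - D.p j k) i) (hq' k)).const_mul (-1)))
    have e : (fun t => LL D j (x + t • ee i)) = fun t => ∑ k,
        (Real.log (‖x - D.p j k‖ ^ 2 + 2 * t * (x - D.p j k) i + t ^ 2) +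
         -1 * Real.log (D.μ + ‖x - D.p j k‖ ^ 2 + 2 * t * (x - D.p j k) i + t ^ 2)) := by
      funext t
      unfold LL
      refine Finset.sum_congr rfl fun k _ => ?_
      rw [key]
      ring_nf
    rw [e]
    exact h
  · rw [Finset.sum_comm, PlanarVortexData.g, ← Finset.sum_neg_distrib]
    refine Finset.sum_congr rfl fun k _ => ?_
    have hs := EuclideanSpace.real_norm_sq_eq (x - D.p j k)
    rw [Fin.sum_univ_two] at hs ⊢
    have h1 := (hq k).ne'
    have h2 := (hq' k).ne'
    generalize ‖x - D.p j k‖ ^ 2 = s at *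
    have e1 : (x - D.p j k) 1 ^ 2 = s - (x - D.p j k) 0 ^ 2 := by linarith
    rw [e1]
    field_simp
    ring

lemma tendsto_LL (j : Fin l) : Tendsto (LL D j) (cocompact E2) (𝓝 0) := by
  have hμ := D.μ_pos
  have : (0:ℝ) = ∑ _k : Fin (D.N j), (0:ℝ) := by simp
  unfold LL
  rw [this]
  refine tendsto_finsetSum _ fun k _ => ?_
  have h1 : Tendsto (fun x : E2 => ‖x - D.p j k‖ ^ 2) (cocompact E2) atTop := by
    have := tendsto_dist_right_cocompact_atTop (D.p j k)
    simp only [dist_eq_norm] at this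
    exact (tendsto_pow_atTop (by norm_num)).comp this
  have h2 : Tendsto (fun s : ℝ => Real.log s - Real.log (D.μ + s)) atTop (𝓝 0) := by
    have h3 : Tendsto (fun s : ℝ => 1 - D.μ / (D.μ + s)) atTop (𝓝 (1 - 0)) :=
      tendsto_const_nhds.sub (Tendsto.const_div_atTop
        (tendsto_atTop_add_const_left _ _ tendsto_id) _)
    rw [sub_zero] at h3
    have h4 := h3.log one_ne_zero
    rw [Real.log_one] at h4
    refine h4.congr' ?_
    filter_upwards [eventually_gt_atTop 0] with s hs
    rw [← Real.log_div hs.ne' (by positivity)]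
    congr 1
    field_simp
    ring
  exact h2.comp h1

lemma continuousAt_LL (j : Fin l) (x : E2) (hx : ∀ k, x ≠ D.p j k) : ContinuousAt (LL D j) x := by
  have hμ := D.μ_pos
  unfold LL
  refine tendsto_finsetSum _ fun k _ => ?_
  have h1 : 0 < ‖x - D.p j k‖ := norm_pos_iff.2 (sub_ne_zero.2 (hx k))
  have hc : ContinuousAt (fun x : E2 => ‖x - D.p j k‖ ^ 2) x := by fun_prop
  have hc' : ContinuousAt (fun x : E2 => D.μ + ‖x - D.p j k‖ ^ 2) x := by fun_prop
  exact (hc.log (by positivity)).sub (hc'.log (by positivity))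

lemma coercive (u : Fin l → ℝ) (ε : ℝ) (hε : 2 * (l + 1) * ε ≤ 1) (hu : ∀ i, |u i| ≤ ε) :
    ∑ j, u j ^ 2 ≤ 2 * ∑ j, u j * ((Real.exp (u j) - 1) + ∑ i, (Real.exp (u i) - 1)) := by
  rcases Nat.eq_zero_or_pos l with rfl | hl
  · simp
  have hl1 : (1:ℝ) ≤ l := by exact_mod_cast hl
  have hε0 : 0 ≤ ε := (abs_nonneg _).trans (hu ⟨0, hl⟩)
  have hε1 : ε ≤ 1 := by nlinarith
  have hr : ∀ i, |Real.exp (u i) - 1 - u i| ≤ u i ^ 2 := fun i =>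
    Real.abs_exp_sub_one_sub_id_le ((hu i).trans hε1)
  set W := ∑ j, u j ^ 2 with hW
  set U := ∑ j, u j with hU
  set r : Fin l → ℝ := fun i => Real.exp (u i) - 1 - u i with hrdef
  have hW0 : 0 ≤ W := Finset.sum_nonneg fun i _ => sq_nonneg _
  have hUle : |U| ≤ l * ε := by
    calc |U| ≤ ∑ j, |u j| := Finset.abs_sum_le_sum_abs _ _
      _ ≤ ∑ _j : Fin l, ε := Finset.sum_le_sum fun i _ => hu i
      _ = l * ε := by simp
  have hRle : |∑ i, r i| ≤ W :=
    (Finset.abs_sum_le_sum_abs _ _).trans (Finset.sum_le_sum fun i _ => hr i)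
  have hH : ∑ i, (Real.exp (u i) - 1) = U + ∑ i, r i := by
    rw [hU, ← Finset.sum_add_distrib]
    exact Finset.sum_congr rfl fun i _ => by simp [hrdef]
  have h1 : (1 - ε) * W ≤ ∑ j, u j * (Real.exp (u j) - 1) := by
    rw [hW, Finset.mul_sum]
    refine Finset.sum_le_sum fun i _ => ?_
    have h2 : |u i * r i| ≤ ε * u i ^ 2 := by
      rw [abs_mul]
      exact mul_le_mul (hu i) (hr i) (abs_nonneg _) hε0
    have h3 := neg_abs_le (u i * r i)
    have h4 : u i * (Real.exp (u i) - 1) = u i ^ 2 + u i * r i := by simp only [hrdef]; ring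
    rw [h4]; linarith
  have h5 : ∑ j, u j * ((Real.exp (u j) - 1) + ∑ i, (Real.exp (u i) - 1)) =
      ∑ j, u j * (Real.exp (u j) - 1) + U * (U + ∑ i, r i) := by
    rw [← hH, hU, Finset.sum_mul, ← Finset.sum_add_distrib]
    exact Finset.sum_congr rfl fun i _ => by ring
  have h6 : |U * ∑ i, r i| ≤ l * ε * W := by
    rw [abs_mul]
    exact mul_le_mul hUle hRle (abs_nonneg _) (by positivity)
  have h7 := neg_abs_le (U * ∑ i, r i)
  rw [h5]
  nlinarith [sq_nonneg U, mul_le_mul_of_nonneg_right hε hW0]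

lemma eventually_cocompact_norm {P : E2 → Prop} (h : ∀ᶠ x in cocompact E2, P x) :
    ∃ R : ℝ, ∀ x, R ≤ ‖x‖ → P x := by
  rw [← Metric.cobounded_eq_cocompact, ← comap_norm_atTop, eventually_comap,
    eventually_atTop] at h
  obtain ⟨R, hR⟩ := h
  exact ⟨R, fun x hx => hR _ hx x rfl⟩

lemma decay (v : Fin l → E2 → ℝ) (hv : IsPlanarVortexSolution D v) :
    ∃ C R : ℝ, 0 ≤ C ∧ ∀ x, R ≤ ‖x‖ → (∀ j k, x ≠ D.p j k) ∧ (∀ j, |v j x + LL D j x| ≤ 1) ∧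
      ∑ j, (v j x + LL D j x) ^ 2 ≤ C * ((1 + ‖x‖ ^ 2) ^ 3)⁻¹ := by
  set u : Fin l → E2 → ℝ := fun j x => v j x + LL D j x with hu
  have hu0 : ∀ j, Tendsto (u j) (cocompact E2) (𝓝 0) := fun j => by
    simpa using (hv j).2.2.add (tendsto_LL D j)
  set ε : ℝ := 1 / (2 * (l + 1)) with hε
  have hεpos : 0 < ε := by positivity
  have hε1 : ε ≤ 1 := by
    rw [hε, div_le_one (by positivity)]
    have : (0:ℝ) ≤ l := by positivity
    linarith
  have ev1 : ∀ᶠ x in cocompact E2, ∀ j k, x ≠ D.p j k := by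
    simp only [eventually_all]
    intro j k
    exact (isCompact_singleton (x := D.p j k)).compl_mem_cocompact
  have ev2 : ∀ᶠ x in cocompact E2, ∀ j, |u j x| ≤ ε := by
    simp only [eventually_all]
    intro j
    have := (hu0 j).abs
    rw [abs_zero] at this
    exact this.eventually_le_const hεpos
  obtain ⟨R0, hR0⟩ := eventually_cocompact_norm (ev1.and ev2)
  set R := max R0 7 with hR
  have hRR : ∀ x : E2, R ≤ ‖x‖ → R0 ≤ ‖x‖ ∧ 7 ≤ ‖x‖ := fun x hx =>
    ⟨(le_max_left _ _).trans hx, (le_max_right _ _).trans hx⟩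
  set W : E2 → ℝ := fun x => ∑ j, u j x ^ 2 with hW
  set B : E2 → ℝ := fun x => ((1 + ‖x‖ ^ 2) ^ 3)⁻¹ with hB
  have hBc : Continuous B := by
    apply Continuous.inv₀ (by fun_prop)
    intro x; positivity
  have hWc : ContinuousOn W {x | R ≤ ‖x‖} := by
    intro x hx
    apply ContinuousAt.continuousWithinAt
    refine tendsto_finsetSum _ fun j _ => ?_
    have h1 := (hv j).1.continuous.continuousAt (x := x)
    have h2 := continuousAt_LL D j x ((hR0 x (hRR x hx).1).1 j)
    exact (h1.add h2).pow 2
  obtain ⟨K, hK⟩ := (isCompact_sphere (0:E2) R).exists_bound_of_continuousOn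
    (hWc.mono (fun x hx => by simp at hx; simp [hx]))
  set C := |K| * (1 + R ^ 2) ^ 3 with hC
  have hC0 : 0 ≤ C := by positivity
  refine ⟨C, R, hC0, fun x hx => ⟨(hR0 x (hRR x hx).1).1,
    fun j => ((hR0 x (hRR x hx).1).2 j).trans hε1, ?_⟩⟩
  by_contra! hcon
  set Φ : E2 → ℝ := fun x => W x + (-C) * B x with hΦ
  have hΦx : 0 < Φ x := by simp only [hΦ, hW, hB]; linarith
  have hW0 : Tendsto W (cocompact E2) (𝓝 0) := by
    have : (0:ℝ) = ∑ _j : Fin l, (0:ℝ) ^ 2 := by simp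
    rw [this]
    exact tendsto_finsetSum _ fun j _ => (hu0 j).pow 2
  have hev : ∀ᶠ y in cocompact E2 ⊓ 𝓟 {x | R ≤ ‖x‖}, Φ y ≤ Φ x := by
    apply Filter.Eventually.filter_mono inf_le_left
    filter_upwards [hW0.eventually_le_const hΦx] with y hy
    have : 0 ≤ C * B y := by simp only [hB]; positivity
    have h2 : Φ y = W y + (-C) * B y := rfl
    linarith
  obtain ⟨y, hyS, hy⟩ := ContinuousOn.exists_isMaxOn' (hWc.add (hBc.continuousOn.const_smul (-C)))
    (isClosed_le continuous_const continuous_norm) (show x ∈ {x | R ≤ ‖x‖} from hx) hev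
  have hyΦ : 0 < Φ y := hΦx.trans_le (hy hx)
  have hyR : R < ‖y‖ := by
    refine lt_of_le_of_ne hyS fun hne => ?_
    have h1 : W y ≤ |K| := (le_abs_self _).trans ((hK y (by simp [hne])).trans (le_abs_self _))
    have h2 : C * B y = |K| := by
      simp only [hB, hC, ← hne]
      field_simp
    have h3 : Φ y = W y + (-C) * B y := rfl
    linarith
  have hloc : IsLocalMax Φ y :=
    IsMaxOn.isLocalMax hy (mem_of_superset
      ((isOpen_lt continuous_const continuous_norm).mem_nhds hyR) fun z (hz : R < ‖z‖) => hz.le)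
  obtain ⟨hyp, hyε⟩ := hR0 y (hRR y hyS).1
  choose b c hbc hsum using fun j => hasD2_LL D j y (hyp j)
  set d : Fin 2 → ℝ := fun i => 48 * y i ^ 2 / (1 + ‖y‖ ^ 2) ^ 5 - 6 / (1 + ‖y‖ ^ 2) ^ 4 with hd
  set c' : Fin l → Fin 2 → ℝ := fun j i =>
    fderiv ℝ (fun z => fderiv ℝ (v j) z (ee i)) y (ee i) + c j i with hc'
  have hdir : ∀ i, ∑ j, 2 * (u j y * c' j i) + (-C) * d i ≤ 0 := by
    intro i
    have hBd : HasD2 (fun t => B (y + t • ee i)) (-6 * y i / (1 + ‖y‖ ^ 2) ^ 4) (d i) := by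
      have := HasD2.inv_quad (1 + ‖y‖ ^ 2) (y i) (by positivity)
      have e : (fun t => B (y + t • ee i)) =
          fun t => ((1 + ‖y‖ ^ 2 + 2 * t * y i + t ^ 2) ^ 3)⁻¹ := by
        funext t
        simp only [hB, norm_line]
        ring_nf
      rw [e]
      exact this
    have hΦd := (HasD2.sum Finset.univ fun j (_ : j ∈ Finset.univ) =>
      ((hasD2_of_contDiff (hv j).1 y (ee i)).add (hbc j i)).sq).add (hBd.const_mul (-C))
    have hm : IsLocalMax (fun t : ℝ => Φ (y + t • ee i)) 0 := by
      have hcont : ContinuousAt (fun t : ℝ => y + t • ee i) 0 := by fun_prop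
      have h1 : Tendsto (fun t : ℝ => y + t • ee i) (𝓝 0) (𝓝 y) := by
        simpa [ContinuousAt] using hcont
      have h2 := h1.eventually hloc
      simpa [IsLocalMax, IsMaxFilter] using h2
    have h3 := hΦd.nonpos_of_isLocalMax hm
    refine le_trans ?_ h3
    gcongr with j _
    simp only [zero_smul, add_zero]
    have : 0 ≤ ((fderiv ℝ (v j) y) (ee i) + b j i) ^ 2 := sq_nonneg _
    simp only [hu, hc']
    linarith
  have hlap : ∀ j, ∑ i, c' j i = (Real.exp (u j y) - 1) + ∑ i, (Real.exp (u i y) - 1) := by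
    intro j
    have h1 := (hv j).2.1 y
    have h2 : ∀ i, Real.exp (u i y) = D.f i y * Real.exp (v i y) := by
      intro i
      rw [hu, Real.exp_add, exp_LL D i y (hyp i), mul_comm]
    simp only [hc', Finset.sum_add_distrib, hsum, h2, Finset.sum_sub_distrib]
    have h3 : ∑ i, fderiv ℝ (fun z => fderiv ℝ (v j) z (ee i)) y (ee i) = lap (v j) y := rfl
    rw [h3, h1]
    simp
    ring
  have hco := coercive (fun j => u j y) ε (by rw [hε]; field_simp; norm_num) hyε
  have hs : ∑ i, (∑ j, 2 * (u j y * c' j i) + (-C) * d i) ≤ 0 :=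
    Finset.sum_nonpos fun i _ => hdir i
  rw [Finset.sum_add_distrib, Finset.sum_comm, ← Finset.mul_sum] at hs
  simp only [← Finset.mul_sum, hlap] at hs
  have hds : ∑ i, d i ≤ B y := by
    have h7 := (hRR y hyS).2
    have hn := EuclideanSpace.real_norm_sq_eq y
    rw [Fin.sum_univ_two] at hn
    have e : ∑ i, d i = (48 * ‖y‖ ^ 2 - 12 * (1 + ‖y‖ ^ 2)) / (1 + ‖y‖ ^ 2) ^ 5 := by
      rw [Fin.sum_univ_two]
      simp only [hd]
      rw [hn]
      field_simp
      ring
    rw [e]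
    simp only [hB]
    rw [div_le_iff₀ (by positivity)]
    have : ((1 + ‖y‖ ^ 2) ^ 3)⁻¹ * (1 + ‖y‖ ^ 2) ^ 5 = (1 + ‖y‖ ^ 2) ^ 2 := by field_simp
    rw [this]
    have h49 : 49 ≤ ‖y‖ ^ 2 := by nlinarith
    generalize ‖y‖ ^ 2 = s at h49
    nlinarith
  have h9 := mul_le_mul_of_nonneg_left hds hC0
  have h10 : Φ y = W y + (-C) * B y := rfl
  have h11 : W y = ∑ j, u j y ^ 2 := rfl
  linarith

end Decay
/-- for a planar vortex solution the total flux is quantized: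
`f_j e^{v_j} + Σ_i f_i e^{v_i} − (l+1)` is integrable on `ℝ²` with integral `−4πN_j`. -/
theorem quantized_flux_planar {l : ℕ} (hl : 2 ≤ l)
    (D : PlanarVortexData l) (v : Fin l → E2 → ℝ)
    (hv : IsPlanarVortexSolution D v) :
    ∀ j : Fin l,
      Integrable
        (fun x => D.f j x * Real.exp (v j x) + ∑ i, D.f i x * Real.exp (v i x) - (l + 1))
        (volume : Measure E2) ∧
      ∫ x : E2, (D.f j x * Real.exp (v j x) + ∑ i, D.f i x * Real.exp (v i x) - (l + 1)) =
        -(4 * π * D.N j) := by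
  intro j
  have hμ := D.μ_pos
  have hg : Integrable (D.g j) volume ∧ ∫ x, D.g j x = 4 * π * D.N j := by
    have h1 : ∀ k, Integrable (fun x => 4 * D.μ / (D.μ + ‖x - D.p j k‖ ^ 2) ^ 2)
        (volume : Measure E2) := fun k => (integral_bubble hμ).1.comp_sub_right (D.p j k)
    have h2 : ∀ k, ∫ x, 4 * D.μ / (D.μ + ‖x - D.p j k‖ ^ 2) ^ 2 = 4 * π := fun k => by
      rw [← (integral_bubble hμ).2]
      exact integral_sub_right_eq_self (fun x : E2 => 4 * D.μ / (D.μ + ‖x‖ ^ 2) ^ 2) (D.p j k)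
    unfold PlanarVortexData.g
    refine ⟨integrable_finsetSum _ fun k _ => h1 k, ?_⟩
    rw [integral_finsetSum _ fun k _ => h1 k]
    simp only [h2]
    simp
    ring
  have hgc : Continuous (D.g j) := by
    unfold PlanarVortexData.g
    refine continuous_finsetSum _ fun k _ => ?_
    refine Continuous.div (by fun_prop) (by fun_prop) fun x => by positivity
  have hFeq : (fun x => D.f j x * Real.exp (v j x) + ∑ i, D.f i x * Real.exp (v i x) - (l + 1)) =
      fun x => lap (v j) x - D.g j x := by
    funext x
    rw [(hv j).2.1 x]
    ring
  have hlc := continuous_lap (hv j).1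
  obtain ⟨C, R, hC, hdec⟩ := decay D v hv
  have hint : Integrable (fun x => D.f j x * Real.exp (v j x) +
      ∑ i, D.f i x * Real.exp (v i x) - (l + 1)) (volume : Measure E2) := by
    have hJ : Integrable (fun x : E2 => ((1 : ℝ) + ‖x‖ ^ 2) ^ (-(3:ℝ) / 2)) volume :=
      integrable_rpow_neg_one_add_norm_sq (by simp; norm_num)
    refine LocallyIntegrable.integrable_of_isBigO_cocompact
      (g := fun x : E2 => ((1 : ℝ) + ‖x‖ ^ 2) ^ (-(3:ℝ) / 2)) ?_ ?_
      (hJ.integrableAtFilter _)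
    · rw [hFeq]
      exact (hlc.sub hgc).locallyIntegrable
    · apply Asymptotics.IsBigO.of_bound ((2 + l * 2) * Real.sqrt C)
      have hfar : ∀ᶠ x in cocompact E2, R ≤ ‖x‖ :=
        (tendsto_norm_cocompact_atTop (E := E2)).eventually_ge_atTop R
      filter_upwards [hfar] with x hx
      obtain ⟨hp, h1, hW⟩ := hdec x hx
      set γ : ℝ := ((1 : ℝ) + ‖x‖ ^ 2) ^ (-(3:ℝ) / 2) with hγ
      have hγ0 : 0 ≤ γ := by positivity
      have hγ2 : γ ^ 2 = ((1 + ‖x‖ ^ 2) ^ 3)⁻¹ := by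
        have hq : (0:ℝ) ≤ 1 + ‖x‖ ^ 2 := by positivity
        rw [hγ]
        generalize 1 + ‖x‖ ^ 2 = q at hq
        rw [← Real.rpow_natCast, ← Real.rpow_mul hq, ← Real.rpow_natCast q 3,
          ← Real.rpow_neg hq]
        norm_num
      have hub : ∀ i, |v i x + LL D i x| ≤ Real.sqrt C * γ := by
        intro i
        apply abs_le_of_sq_le_sq _ (by positivity)
        rw [mul_pow, Real.sq_sqrt hC, hγ2]
        exact (Finset.single_le_sum (f := fun i => (v i x + LL D i x) ^ 2)
          (fun i _ => sq_nonneg _) (Finset.mem_univ i)).trans hW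
      have hhb : ∀ i, |D.f i x * Real.exp (v i x) - 1| ≤ 2 * (Real.sqrt C * γ) := by
        intro i
        have e : D.f i x * Real.exp (v i x) = Real.exp (v i x + LL D i x) := by
          rw [Real.exp_add, exp_LL D i x (hp i), mul_comm]
        rw [e]
        exact (Real.abs_exp_sub_one_le (h1 i)).trans (by linarith [hub i])
      have hF : D.f j x * Real.exp (v j x) + ∑ i, D.f i x * Real.exp (v i x) - (l + 1) =
          (D.f j x * Real.exp (v j x) - 1) + ∑ i, (D.f i x * Real.exp (v i x) - 1) := by
        rw [Finset.sum_sub_distrib]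
        simp
        ring
      rw [hF, Real.norm_eq_abs, Real.norm_eq_abs, abs_of_nonneg hγ0]
      have hs : |∑ i, (D.f i x * Real.exp (v i x) - 1)| ≤ l * (2 * (Real.sqrt C * γ)) := by
        refine (Finset.abs_sum_le_sum_abs _ _).trans ?_
        refine (Finset.sum_le_sum fun i _ => hhb i).trans ?_
        simp
      have := abs_add_le (D.f j x * Real.exp (v j x) - 1) (∑ i, (D.f i x * Real.exp (v i x) - 1))
      have := hhb j
      nlinarith
  refine ⟨hint, ?_⟩
  have hlapint : Integrable (lap (v j)) volume := by
    have := hint.add hg.1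
    rw [hFeq] at this
    refine this.congr (Eventually.of_forall fun x => ?_)
    simp
  have h0 := integral_lap_eq_zero (hv j).1 (hv j).2.2 hlapint
  rw [hFeq, integral_sub hlapint hg.1, h0, hg.2]
  ring
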